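/- arXiv:1409.5949 — 2 statements merged into one kernel-verified Lean document; each statement's English description precedes it below -/
import Mathlib

section
/- Let R be a prime ring and d a derivation of R such that (d(xy))^n = (d(x))^n (d(y))^n for all x, y in R, where n ≥ 1 is a fixed integer. Then d = 0 or R is commutative. -/
/-- The working hypotheses: a prime ring with a derivation whose values are nilpotent of
bounded index. -/
structure NilDer {R : Type*} [Ring R] (d : R → R) (n : ℕ) : Prop where
  prime : ∀ a b : R, (∀ r : R, a * r * b = 0) → a = 0 ∨ b = 0
  add : ∀ x y : R, d (x + y) = d x + d y
  leib : ∀ x y : R, d (x * y) = d x * y + x * d y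
  nil : ∀ x : R, d x ^ n = 0

/-- A right ideal that is stable under `d`. -/
structure StableRight {R : Type*} [Ring R] (d : R → R) (J : R → Prop) : Prop where
  add : ∀ x y : R, J x → J y → J (x + y)
  mul : ∀ x r : R, J x → J (x * r)
  der : ∀ x : R, J x → J (d x)

/-- The lemma of Levitzki for prime rings. -/
theorem levitzki_aux {R : Type*} [Ring R]
    (hp : ∀ a b : R, (∀ r : R, a * r * b = 0) → a = 0 ∨ b = 0) (m : ℕ) :
    ∀ a : R, (∀ r : R, (a * r) ^ m * a = 0) → a = 0 := by
  induction m with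
  | zero => intro a h; simpa using h 0
  | succ m ih =>
    intro a h
    by_contra ha
    rcases Nat.eq_zero_or_pos m with hm | hm
    · subst hm
      rcases hp a a (fun r => by simpa using h r) with h1 | h1 <;> exact ha h1
    have hex : ∃ r0, (a * r0) ^ m * a ≠ 0 := by
      by_contra hc
      push Not at hc
      exact ha (ih a hc)
    obtain ⟨r0, hr0⟩ := hex
    set u := (a * r0) ^ m * a with hu
    have hau : a * r0 * u = 0 := by
      rw [hu, ← mul_assoc, ← pow_succ']; exact h r0
    have hara : a * r0 * a ≠ 0 := by
      intro h0
      apply hr0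
      obtain ⟨j, rfl⟩ : ∃ j, m = j + 1 := ⟨m - 1, by omega⟩
      rw [hu, pow_succ, mul_assoc, h0, mul_zero]
    have hJ : ∀ y : R, ∃ z, u * y = a * z := by
      intro y
      obtain ⟨j, rfl⟩ : ∃ j, m = j + 1 := ⟨m - 1, by omega⟩
      exact ⟨r0 * (a * r0) ^ j * a * y, by rw [hu, pow_succ']; simp only [mul_assoc]⟩
    have key : ∀ x y : R, (u * x) ^ m * u * y * (a * r0 * a) = 0 := by
      intro x y
      set q := u * x with hq
      set p := u * y * (a * r0) with hpp
      have hpq : p * q = 0 := by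
        rw [hpp, hq]
        calc u * y * (a * r0) * (u * x) = u * y * (a * r0 * u) * x := by noncomm_ring
          _ = 0 := by rw [hau]; simp
      have hp2 : p * p = 0 := by
        rw [hpp]
        calc u * y * (a * r0) * (u * y * (a * r0)) = u * y * (a * r0 * u) * y * (a * r0) := by
              noncomm_ring
          _ = 0 := by rw [hau]; simp
      have hpow : ∀ j : ℕ, (p + q) ^ (j + 1) = q ^ (j + 1) + q ^ j * p := by
        intro j
        induction j with
        | zero => simp [add_comm]
        | succ j ihj =>
          rw [pow_succ, ihj]
          have e1 : q ^ j * p * (p + q) = 0 := by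
            rw [mul_assoc, mul_add, hp2, hpq]; simp
          rw [add_mul, e1, mul_add, add_zero, add_comm, ← pow_succ]
      obtain ⟨z1, hz1⟩ := hJ (y * (a * r0))
      obtain ⟨z2, hz2⟩ := hJ x
      have hsum : p + q = a * (z1 + z2) := by
        rw [mul_add, ← hz1, ← hz2, hpp, hq, mul_assoc]
      have h1 := h (z1 + z2)
      rw [← hsum, hpow, add_mul] at h1
      have h2 := h z2
      rw [← hz2] at h2
      rw [h2, zero_add, hpp] at h1
      rw [← h1]; noncomm_ring
    have h3 : ∀ x, (u * x) ^ m * u = 0 := by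
      intro x
      rcases hp _ _ (key x) with h4 | h4
      · exact h4
      · exact absurd h4 hara
    exact hr0 (ih u h3)

theorem levitzki {R : Type*} [Ring R]
    (hp : ∀ a b : R, (∀ r : R, a * r * b = 0) → a = 0 ∨ b = 0) (m : ℕ)
    (a : R) (h : ∀ r : R, (a * r) ^ m = 0) : a = 0 :=
  levitzki_aux hp m a (fun r => by rw [h r, zero_mul])

/-- If `(g r)^m h = 0` for all `r` then `g = 0` or `h = 0`. -/
theorem levitzki_two {R : Type*} [Ring R]
    (hp : ∀ a b : R, (∀ r : R, a * r * b = 0) → a = 0 ∨ b = 0) (m : ℕ)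
    (g h : R) (H : ∀ r : R, (g * r) ^ m * h = 0) : g = 0 ∨ h = 0 := by
  induction m with
  | zero => right; simpa using H 0
  | succ m ih =>
    by_contra hgh
    rcases Nat.eq_zero_or_pos m with hm | hm
    · subst hm
      exact hgh (hp g h (fun r => by simpa using H r))
    have hex : ∃ r0, (g * r0) ^ m * h ≠ 0 := by
      by_contra hc
      push Not at hc
      exact hgh (ih hc)
    obtain ⟨r0, hr0⟩ := hex
    set u := (g * r0) ^ m * h with hu
    have hau : g * r0 * u = 0 := by
      rw [hu, ← mul_assoc, ← pow_succ']; exact H r0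
    have hara : g * r0 * h ≠ 0 := by
      intro h0
      apply hr0
      obtain ⟨j, rfl⟩ : ∃ j, m = j + 1 := ⟨m - 1, by omega⟩
      rw [hu, pow_succ, mul_assoc, h0, mul_zero]
    have hJ : ∀ y : R, ∃ z, u * y = g * z := by
      intro y
      obtain ⟨j, rfl⟩ : ∃ j, m = j + 1 := ⟨m - 1, by omega⟩
      exact ⟨r0 * (g * r0) ^ j * h * y, by rw [hu, pow_succ']; simp only [mul_assoc]⟩
    have key : ∀ x y : R, (u * x) ^ m * u * y * (g * r0 * h) = 0 := by
      intro x y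
      set q := u * x with hq
      set p := u * y * (g * r0) with hpp
      have hpq : p * q = 0 := by
        rw [hpp, hq]
        calc u * y * (g * r0) * (u * x) = u * y * (g * r0 * u) * x := by noncomm_ring
          _ = 0 := by rw [hau]; simp
      have hp2 : p * p = 0 := by
        rw [hpp]
        calc u * y * (g * r0) * (u * y * (g * r0)) = u * y * (g * r0 * u) * y * (g * r0) := by
              noncomm_ring
          _ = 0 := by rw [hau]; simp
      have hpow : ∀ j : ℕ, (p + q) ^ (j + 1) = q ^ (j + 1) + q ^ j * p := by
        intro j
        induction j with
        | zero => simp [add_comm]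
        | succ j ihj =>
          rw [pow_succ, ihj]
          have e1 : q ^ j * p * (p + q) = 0 := by
            rw [mul_assoc, mul_add, hp2, hpq]; simp
          rw [add_mul, e1, mul_add, add_zero, add_comm, ← pow_succ]
      obtain ⟨z1, hz1⟩ := hJ (y * (g * r0))
      obtain ⟨z2, hz2⟩ := hJ x
      have hsum : p + q = g * (z1 + z2) := by
        rw [mul_add, ← hz1, ← hz2, hpp, hq, mul_assoc]
      have h1 := H (z1 + z2)
      rw [← hsum, hpow, add_mul] at h1
      have h2 := H z2
      rw [← hz2] at h2
      rw [h2, zero_add, hpp] at h1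
      rw [← h1]; noncomm_ring
    have h3 : ∀ x, (u * x) ^ m * u = 0 := by
      intro x
      rcases hp _ _ (key x) with h4 | h4
      · exact h4
      · exact absurd h4 hara
    exact hr0 (levitzki_aux hp m u h3)

namespace NilDer

variable {R : Type*} [Ring R] {d : R → R} {n : ℕ}

theorem lev (H : NilDer d n) (m : ℕ) (a : R) (h : ∀ r : R, (a * r) ^ m = 0) : a = 0 :=
  levitzki H.prime m a h

theorem map_zero (H : NilDer d n) : d 0 = 0 := by
  have := H.add 0 0
  simpa using this

theorem map_neg (H : NilDer d n) (x : R) : d (-x) = - d x := by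
  have := H.add x (-x)
  rw [add_neg_cancel, H.map_zero] at this
  exact (neg_eq_of_add_eq_zero_right this.symm).symm

theorem map_sub (H : NilDer d n) (x y : R) : d (x - y) = d x - d y := by
  rw [sub_eq_add_neg, H.add, H.map_neg, ← sub_eq_add_neg]

theorem map_one (H : NilDer d n) : d 1 = 0 := by
  have := H.leib 1 1
  simpa using this

/-- If a product vanishes, it still vanishes after differentiating the right factor. -/
theorem right (H : NilDer d n) {a b : R} (hab : a * b = 0) : a * d b = 0 := by
  apply H.lev (n + 1)
  intro r
  have hstep : a * d (b * r * a) = a * d b * r * a := by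
    rw [mul_assoc b, H.leib, mul_add]
    calc a * (d b * (r * a)) + a * (b * d (r * a))
        = a * d b * r * a + (a * b) * d (r * a) := by noncomm_ring
      _ = _ := by rw [hab]; simp
  have hpow : ∀ k : ℕ, a * d (b * r * a) ^ k = (a * d b * r) ^ k * a := by
    intro k
    induction k with
    | zero => simp
    | succ k ih =>
      rw [pow_succ, ← mul_assoc, ih, mul_assoc, hstep, pow_succ]; noncomm_ring
  have h0 := hpow n
  rw [H.nil, mul_zero] at h0
  rw [pow_succ]
  calc (a * d b * r) ^ n * (a * d b * r) = ((a * d b * r) ^ n * a) * (d b * r) := by noncomm_ring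
    _ = 0 := by rw [← h0, zero_mul]

theorem left (H : NilDer d n) {a b : R} (hab : a * b = 0) : d a * b = 0 := by
  have h := H.leib a b
  rw [hab, H.map_zero, H.right hab, add_zero] at h
  exact h.symm

/-- The descent step. -/
theorem descent (H : NilDer d n) {J : R → Prop} (hJ : StableRight d J) {k : ℕ} {s p q : R}
    (hk : ∀ x, J x → d x ^ (k + 1) * s = 0) (hp : J p) (hq : J q)
    (hpp : p * p = 0) (hpq : p * q = 0) : d q ^ k * (d p * s) = 0 := by
  have e1 : d p * d p = 0 := H.left (H.right hpp)
  have e2 : d p * d q = 0 := H.left (H.right hpq)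
  have hpow : ∀ j : ℕ, (d p + d q) ^ (j + 1) = d q ^ (j + 1) + d q ^ j * d p := by
    intro j
    induction j with
    | zero => simp [add_comm]
    | succ j ihj =>
      rw [pow_succ, ihj]
      have e3 : d q ^ j * d p * (d p + d q) = 0 := by
        rw [mul_assoc, mul_add, e1, e2]; simp
      rw [add_mul, e3, mul_add, add_zero, add_comm, ← pow_succ]
  have h1 := hk _ (hJ.add p q hp hq)
  rw [H.add, hpow, add_mul, hk q hq, zero_add] at h1
  rw [← mul_assoc]; exact h1

theorem inter (H : NilDer d n) {J : R → Prop} (hJ : StableRight d J) (g : R) :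
    StableRight d (fun x => J x ∧ g * x = 0) where
  add x y hx hy := ⟨hJ.add x y hx.1 hy.1, by rw [mul_add, hx.2, hy.2, add_zero]⟩
  mul x r hx := ⟨hJ.mul x r hx.1, by rw [← mul_assoc, hx.2, zero_mul]⟩
  der x hx := ⟨hJ.der x hx.1, H.right hx.2⟩

/-- Last nonzero iterate. -/
theorem last (H : NilDer d n) (w s : R) (h : d w * s ≠ 0) :
    ∃ j : ℕ, d w ^ (j + 1) * s ≠ 0 ∧ d w * (d w ^ (j + 1) * s) = 0 := by
  classical
  have hex : ∃ m, d w ^ m * s = 0 := ⟨n, by rw [H.nil, zero_mul]⟩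
  have hs : s ≠ 0 := by rintro rfl; simp at h
  have h0 := Nat.find_spec hex
  have hmin := fun m => Nat.find_min hex (m := m)
  set m := Nat.find hex
  have hm0 : m ≠ 0 := by intro e; rw [e] at h0; simp at h0; exact hs h0
  have hm1 : m ≠ 1 := by intro e; rw [e] at h0; simp at h0; exact h h0
  obtain ⟨j, hj⟩ : ∃ j, m = j + 2 := ⟨m - 2, by omega⟩
  refine ⟨j, hmin (j + 1) (by omega), ?_⟩
  rw [hj] at h0
  rw [← mul_assoc, ← pow_succ']; exact h0

/-- First stage. -/
theorem exists_t_aux (H : NilDer d n) (k : ℕ) : ∀ (J : R → Prop) (s : R), StableRight d J →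
    (∃ x, J x ∧ x ≠ 0) → s ≠ 0 → (∀ x, J x → d x ^ k * s = 0) →
    ∃ t : R, t ≠ 0 ∧ ∃ s : R, s ≠ 0 ∧ ∀ r, d (t * r) * s = 0 := by
  induction k with
  | zero =>
    rintro J s hJ ⟨x, hx, hx0⟩ hs hk
    exact absurd (by simpa using hk x hx) hs
  | succ k ih =>
    rintro J s hJ ⟨x, hx, hx0⟩ hs hk
    by_contra hno
    have hsq : ∀ p, J p → p * p = 0 → d p * s = 0 := by
      intro p hp hpp
      by_contra hps
      apply hno
      refine ih (fun x => J x ∧ p * x = 0) (d p * s) (H.inter hJ p) ⟨p, ⟨hp, hpp⟩, ?_⟩ hps ?_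
      · rintro rfl; rw [H.map_zero] at hps; simp at hps
      · intro q hq
        exact H.descent hJ hk hp hq.1 hpp hq.2
    have hts : ∀ t, J t → t * t = 0 → t * s = 0 := by
      intro t ht htt
      by_contra hne
      apply hno
      refine ⟨t, by rintro rfl; simp at hne, t * s, hne, ?_⟩
      intro r
      have h1 := hsq (t * r * t) (hJ.mul _ _ (hJ.mul _ _ ht)) (by
        calc t * r * t * (t * r * t) = t * r * (t * t) * r * t := by noncomm_ring
          _ = 0 := by rw [htt]; simp)
      rw [H.leib, add_mul, mul_assoc (t * r), hsq t ht htt, mul_zero, add_zero, mul_assoc] at h1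
      exact h1
    by_cases hw : ∀ w, J w → d w * s = 0
    · exact hno ⟨x, hx0, s, hs, fun r => hw _ (hJ.mul _ _ hx)⟩
    push Not at hw
    obtain ⟨w, hw, hws⟩ := hw
    have hdw : d w * 1 ≠ 0 := by
      intro e; rw [mul_one] at e; rw [e, zero_mul] at hws; exact hws rfl
    obtain ⟨j, hj1, hj2⟩ := H.last w 1 hdw
    rw [mul_one] at hj1 hj2
    have hJx : J (d w ^ (j + 1)) := by
      rw [pow_succ']; exact hJ.mul _ _ (hJ.der _ hw)
    have : ∀ r, d w ^ (j + 1) * r * (d w * s) = 0 := by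
      intro r
      have := hts (d w ^ (j + 1) * r * d w) (hJ.mul _ _ (hJ.mul _ _ hJx)) (by
        calc d w ^ (j + 1) * r * d w * (d w ^ (j + 1) * r * d w)
            = d w ^ (j + 1) * r * (d w * d w ^ (j + 1)) * r * d w := by noncomm_ring
          _ = 0 := by rw [hj2]; simp)
      rw [← mul_assoc]; exact this
    rcases H.prime _ _ this with h | h
    · exact hj1 h
    · exact hws h

theorem exists_t (H : NilDer d n) (h1 : (1 : R) ≠ 0) :
    ∃ t : R, t ≠ 0 ∧ ∀ x, d (t * x) * t = 0 := by
  obtain ⟨t, ht, s, hs, hts⟩ := H.exists_t_aux n (fun _ => True) 1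
    ⟨fun _ _ _ _ => trivial, fun _ _ _ => trivial, fun _ _ => trivial⟩ ⟨1, trivial, h1⟩ h1
    (fun x _ => by rw [H.nil, zero_mul])
  refine ⟨t, ht, fun x => ?_⟩
  have : ∀ y, d (t * x) * t * y * s = 0 := by
    intro y
    have e := hts (x * (t * y))
    rw [← mul_assoc, H.leib, add_mul, mul_assoc (t * x), hts y, mul_zero, add_zero] at e
    rw [← e]; noncomm_ring
  rcases H.prime _ _ this with h | h
  · exact h
  · exact absurd h hs

/-- Lemma F. -/
theorem lemF (H : NilDer d n) (hd : ∃ x, d x ≠ 0) {t : R} (ht0 : t ≠ 0)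
    (ht : ∀ x, d (t * x) * t = 0) {p : R} (hp : ∀ b, d (d (p * b)) * t = 0) :
    ∀ b, d (p * b) * t = 0 := by
  intro b
  have hy : ∃ y, d y * t ≠ 0 := by
    by_contra hc
    push Not at hc
    obtain ⟨x, hx⟩ := hd
    have : ∀ c, d x * c * t = 0 := by
      intro c
      have e := hc (x * c)
      rw [H.leib, add_mul, mul_assoc x, hc c, mul_zero, add_zero] at e
      exact e
    rcases H.prime _ _ this with h | h
    · exact hx h
    · exact ht0 h
  obtain ⟨y0, hy0⟩ := hy
  have key : ∀ a, (d (p * b) * t * a) ^ n * (d y0 * t) = 0 := by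
    intro a
    set x := p * b * t * a with hx
    have step : ∀ y, d (d x * y) * t = - (d (p * b) * t * a * (d y * t)) := by
      intro y
      have e1 : d x * y = d (x * y) - x * d y := eq_sub_of_add_eq (H.leib x y).symm
      have e2 : d (d (x * y)) * t = 0 := by
        have := hp (b * t * a * y)
        rw [hx]; rw [← this]; congr 3; noncomm_ring
      have e3 : d (x * d y) * t = d (p * b) * t * a * (d y * t) := by
        have : x * d y = p * b * (t * (a * d y)) := by rw [hx]; noncomm_ring
        rw [this, H.leib, add_mul, mul_assoc (p * b), ht, mul_zero, add_zero]; noncomm_ring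
      rw [e1, H.map_sub, sub_mul, e2, e3, zero_sub]
    have hpow : ∀ k : ℕ, d (d x ^ k * y0) * t
        = (-1) ^ k * ((d (p * b) * t * a) ^ k * (d y0 * t)) := by
      intro k
      induction k with
      | zero => simp
      | succ k ih =>
        rw [pow_succ', mul_assoc, step, ih]
        rcases neg_one_pow_eq_or R k with h | h <;> simp [h, pow_succ'] <;> noncomm_ring
    have h0 := hpow n
    rw [H.nil, zero_mul, H.map_zero, zero_mul] at h0
    rcases neg_one_pow_eq_or R n with h | h
    · rw [h, one_mul] at h0; exact h0.symm
    · rw [h, neg_one_mul] at h0; exact neg_eq_zero.mp h0.symm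
  rcases levitzki_two H.prime n _ _ key with h | h
  · exact h
  · exact absurd h hy0

/-- Lemma M. -/
theorem lemM (H : NilDer d n) {t : R} (ht0 : t ≠ 0)
    (ht : ∀ x, d (t * x) * t = 0) {p a1 b : R} (hpb : ∀ c, d (p * c * a1) * t = p * c * b) :
    a1 * t = 0 ∨ ∀ c, d (p * c) * t = 0 := by
  by_cases hp0 : p = 0
  · right; intro c; rw [hp0, zero_mul, H.map_zero, zero_mul]
  set a := a1 * t with ha
  have hcomm : ∀ e, b * e * a = a * e * b := by
    intro e
    have : ∀ c, p * c * (b * e * a - a * e * b) = 0 := by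
      intro c
      have e1 := hpb (c * a * e)
      have e2 : p * (c * a * e) * a1 = p * c * a1 * (t * (e * a1)) := by rw [ha]; noncomm_ring
      rw [e2, H.leib, add_mul, mul_assoc (p * c * a1), ht, mul_zero, add_zero] at e1
      have e3 : d (p * c * a1) * (t * (e * a1)) * t = p * c * b * e * a := by
        rw [← hpb c, ha]; noncomm_ring
      rw [e3] at e1
      calc p * c * (b * e * a - a * e * b) = p * c * b * e * a - p * (c * a * e) * b := by
            noncomm_ring
        _ = 0 := by rw [e1, sub_self]
    rcases H.prime _ _ this with h | h
    · exact absurd h hp0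
    · exact sub_eq_zero.mp h
  have hb : b = 0 := by
    by_contra hb0
    have hex : ∃ e, (b * e) ^ (2 * n) ≠ 0 := by
      by_contra hc
      push Not at hc
      exact hb0 (H.lev _ b hc)
    obtain ⟨e, he⟩ := hex
    have hE : ∀ g1 g2, p * (-(g1 * t * g2 * p)) ^ n = 0 := by
      intro g1 g2
      set x := p * g1 + t * g2 with hx
      have s1 : ∀ r, d x * (p * r * a) = -(t * g2 * p * r * b) := by
        intro r
        have e1 : d x * (p * r * a) = d (x * (p * r * a1)) * t - x * (d (p * r * a1) * t) := by
          rw [H.leib, ha]; noncomm_ring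
        have e2 : x * (p * r * a1) = p * (g1 * p * r) * a1 + t * (g2 * p * r * a1) := by
          rw [hx]; noncomm_ring
        rw [e1, e2, H.add, add_mul, ht, hpb, hpb, hx]; noncomm_ring
      have s2 : ∀ c, d x * (t * c * a) = p * g1 * t * c * b := by
        intro c
        have e1 : d x * (t * c * a) = d (x * (t * (c * a1))) * t - x * (d (t * (c * a1)) * t) := by
          rw [H.leib, ha]; noncomm_ring
        have e2 : x * (t * (c * a1)) = p * (g1 * t * c) * a1 + t * (g2 * t * c * a1) := by
          rw [hx]; noncomm_ring
        rw [e1, e2, H.add, add_mul, ht, ht, hpb]; noncomm_ring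
      have s3 : ∀ r m, d x * (d x * (p * r * ((a * e) * (a * e)) * m))
          = p * (-(g1 * t * g2 * p) * r) * ((b * e) * (b * e)) * m := by
        intro r m
        calc d x * (d x * (p * r * ((a * e) * (a * e)) * m))
            = d x * ((d x * (p * r * a)) * e * a * e * m) := by noncomm_ring
          _ = -(d x * (t * g2 * p * r * (b * e * a) * e * m)) := by rw [s1]; noncomm_ring
          _ = -((d x * (t * (g2 * p * r) * a)) * e * b * e * m) := by rw [hcomm]; noncomm_ring
          _ = _ := by rw [s2]; noncomm_ring
      have hc2 : Commute (b * e) (a * e) := by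
        change b * e * (a * e) = a * e * (b * e)
        rw [← mul_assoc, hcomm]; noncomm_ring
      have hpow : ∀ i : ℕ, ∀ r m, (d x) ^ (2 * i) * (p * r * (a * e) ^ (2 * i) * m)
          = p * ((-(g1 * t * g2 * p)) ^ i * r) * (b * e) ^ (2 * i) * m := by
        intro i
        induction i with
        | zero => intro r m; simp
        | succ i ih =>
          intro r m
          have hc3 : (b * e) ^ 2 * (a * e) ^ (2 * i) = (a * e) ^ (2 * i) * (b * e) ^ 2 :=
            (hc2.pow_pow 2 (2 * i)).eq
          have q1 : (a * e) ^ (2 * (i + 1)) = ((a * e) * (a * e)) * (a * e) ^ (2 * i) := by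
            rw [mul_add, mul_one, add_comm, pow_add, pow_two]
          have q2 : (b * e) ^ (2 * (i + 1)) = (b * e) ^ (2 * i) * (b * e) ^ 2 := by
            rw [mul_add, mul_one, pow_add]
          have q3 : (d x) ^ (2 * (i + 1)) = (d x) ^ (2 * i) * (d x * d x) := by
            rw [mul_add, mul_one, pow_add, pow_two]
          rw [q1, q2, q3, pow_succ (-(g1 * t * g2 * p)) i]
          generalize -(g1 * t * g2 * p) = E at *
          calc d x ^ (2 * i) * (d x * d x) * (p * r * (a * e * (a * e) * (a * e) ^ (2 * i)) * m)
              = d x ^ (2 * i) *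
                (d x * (d x * (p * r * ((a * e) * (a * e)) * ((a * e) ^ (2 * i) * m)))) := by
                  simp only [mul_assoc]
            _ = d x ^ (2 * i) * (p * (E * r) * (((b * e) ^ 2 * (a * e) ^ (2 * i)) * m)) := by
                  rw [s3, pow_two]; simp only [mul_assoc]
            _ = d x ^ (2 * i) * (p * (E * r) * (a * e) ^ (2 * i) * ((b * e) ^ 2 * m)) := by
                  rw [hc3]; simp only [mul_assoc]
            _ = _ := by rw [ih]; simp only [mul_assoc]
      have hfin : ∀ r, p * (-(g1 * t * g2 * p)) ^ n * r * (b * e) ^ (2 * n) = 0 := by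
        intro r
        have h0 := hpow n r 1
        rw [two_mul, pow_add (d x), H.nil, zero_mul, zero_mul, ← two_mul, mul_one] at h0
        rw [h0]; simp only [mul_assoc]
      rcases H.prime _ _ hfin with h | h
      · exact h
      · exact absurd h he
    have hE2 : ∀ g2, t * g2 * p = 0 := by
      intro g2
      apply H.lev (n + 1)
      intro g1
      have h0 := hE (-g1) g2
      have h1 : -(-g1 * t * g2 * p) = g1 * (t * g2 * p) := by noncomm_ring
      rw [h1] at h0
      have h2 : ∀ k : ℕ, (t * g2 * p * g1) ^ (k + 1) = t * g2 * (p * (g1 * (t * g2 * p)) ^ k) * g1 := by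
        intro k
        induction k with
        | zero => simp [mul_assoc]
        | succ k ih => rw [pow_succ, ih, pow_succ (g1 * (t * g2 * p))]; simp only [mul_assoc]
      rw [h2, h0]; simp
    rcases H.prime _ _ hE2 with h | h
    · exact ht0 h
    · exact hp0 h
  by_cases ha0 : a = 0
  · left; exact ha0
  right
  intro c
  have : ∀ e, d (p * c) * t * e * a = 0 := by
    intro e
    have e1 := hpb (c * t * e)
    have e2 : p * (c * t * e) * a1 = p * c * (t * (e * a1)) := by noncomm_ring
    rw [e2, H.leib, add_mul, mul_assoc (p * c), ht, hb] at e1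
    simp only [mul_zero, add_zero] at e1
    rw [← e1, ha]; noncomm_ring
  rcases H.prime _ _ this with h | h
  · exact h
  · exact absurd h ha0

/-- Second stage. -/
theorem final_aux (H : NilDer d n) (hd : ∃ x, d x ≠ 0) {t : R} (ht0 : t ≠ 0)
    (ht : ∀ x, d (t * x) * t = 0) (k : ℕ) : ∀ (J : R → Prop) (s1 : R), StableRight d J →
    (∃ p, J p ∧ ¬ ∀ b, d (p * b) * t = 0) → s1 * t ≠ 0 →
    (∀ x, J x → d x ^ k * (s1 * t) = 0) → False := by
  induction k with
  | zero =>
    rintro J s hJ ⟨x, hx, hx0⟩ hs hk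
    exact absurd (by simpa using hk x hx) hs
  | succ k ih =>
    rintro J s1 hJ ⟨p0, hp0, hbad0⟩ hs hk
    have star : ∀ p g, J p → (¬ ∀ b, d (p * b) * t = 0) → g * p = 0 → g * (s1 * t) = 0 := by
      intro p g hp hbad hgp
      have hN : ∀ r, d (p * r * g) * (s1 * t) = 0 := by
        intro r
        by_contra hne
        refine ih (fun x => J x ∧ g * x = 0) (d (p * r * g) * s1) (H.inter hJ g)
          ⟨p, ⟨hp, hgp⟩, hbad⟩ (by rw [mul_assoc]; exact hne) ?_
        intro q hq
        rw [mul_assoc (d (p * r * g))]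
        refine H.descent hJ hk (hJ.mul _ _ (hJ.mul _ _ hp)) hq.1 ?_ ?_
        · calc p * r * g * (p * r * g) = p * r * (g * p) * r * g := by noncomm_ring
            _ = 0 := by rw [hgp]; simp
        · rw [mul_assoc, hq.2, mul_zero]
      have := H.lemM ht0 ht (p := p) (a1 := g * s1) (b := g * d s1 * t) (by
        intro c
        have e1 : p * c * (g * s1) = p * c * g * s1 := by noncomm_ring
        rw [e1, H.leib, add_mul, mul_assoc (d _), hN]; noncomm_ring)
      rcases this with h | h
      · rw [← mul_assoc]; exact h
      · exact absurd h hbad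
    have hF : ∃ b, d (d (p0 * b)) * t ≠ 0 := by
      by_contra hc
      push Not at hc
      exact hbad0 (H.lemF hd ht0 ht hc)
    obtain ⟨b, hb⟩ := hF
    set ρ := p0 * b with hρ
    have hJρ : J ρ := hJ.mul _ _ hp0
    set p := d ρ * t with hp
    have hJp : J p := hJ.mul _ _ (hJ.der _ hJρ)
    have hpc : ∀ c, d (p * c) * t = d (d ρ) * t * c * t := by
      intro c
      rw [hp, mul_assoc (d ρ), H.leib, add_mul, mul_assoc (d ρ), ht, mul_zero, add_zero]
      noncomm_ring
    have hpbad : ¬ ∀ c, d (p * c) * t = 0 := by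
      intro hc
      rcases H.prime (d (d ρ) * t) t (fun c => by rw [← hpc, hc]) with h | h
      · exact hb h
      · exact ht0 h
    have hw : ∃ h, d (p * h) * (s1 * t) ≠ 0 := by
      by_contra hc
      push Not at hc
      rcases H.lemM ht0 ht (p := p) (a1 := s1) (b := d s1 * t) (by
        intro c
        rw [H.leib, add_mul, mul_assoc (d _), hc]; noncomm_ring) with h | h
      · exact hs h
      · exact hpbad h
    obtain ⟨h, hh⟩ := hw
    obtain ⟨j, hj1, hj2⟩ := H.last (p * h) (s1 * t) hh
    set u := d (p * h) with hu
    have hJz : J (u ^ (j + 1) * (s1 * t)) := by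
      rw [pow_succ', mul_assoc]
      exact hJ.mul _ _ (hJ.der _ (hJ.mul _ _ hJp))
    have hZ : ∀ b, d (u ^ (j + 1) * (s1 * t) * b) * t = 0 := by
      by_contra hc
      exact hh (star _ u hJz hc hj2)
    set y := u ^ j * s1 with hy
    have hz : u ^ (j + 1) * (s1 * t) = u * (y * t) := by
      rw [pow_succ', hy]; noncomm_ring
    rw [hz] at hj1 hZ
    set ζ := d ρ * (t * (h * y)) - ρ * (t * (h * d y)) with hζ
    have hz2 : u * (y * t) = d ζ * t := by
      have e1 : u * (y * t) = d (p * (h * y)) * t - p * h * d y * t := by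
        rw [← mul_assoc p, H.leib (p * h)]; noncomm_ring
      rw [e1, hpc, hζ, H.map_sub, H.leib (d ρ) (t * (h * y)), H.leib ρ (t * (h * d y)),
        sub_mul, add_mul, add_mul, mul_assoc (d ρ) (d _), ht, mul_assoc ρ (d _), ht, hp]
      noncomm_ring
    rw [hz2] at hj1 hZ
    have hFζ := H.lemF hd ht0 ht (p := ζ * t) (by
      intro b
      have e0 : d (d (t * b)) * t = 0 := H.left (ht b)
      rw [mul_assoc, H.leib, H.add, H.leib ζ, add_mul, add_mul, mul_assoc (d ζ) (d _), ht,
        mul_assoc ζ, e0, ← mul_assoc, hZ b]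
      simp)
    have : ∀ b, d ζ * t * b * t = 0 := by
      intro b
      have e := hFζ b
      rw [mul_assoc ζ, H.leib, add_mul, mul_assoc ζ, ht, mul_zero, add_zero] at e
      rw [← e]; noncomm_ring
    rcases H.prime _ _ this with h | h
    · exact hj1 h
    · exact ht0 h

theorem eq_zero (H : NilDer d n) (x : R) : d x = 0 := by
  by_contra hx
  have h1 : (1 : R) ≠ 0 := by
    intro h
    apply hx
    rw [← mul_one (d x), h, mul_zero]
  obtain ⟨t, ht0, ht⟩ := H.exists_t h1
  refine H.final_aux ⟨x, hx⟩ ht0 ht n (fun _ => True) 1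
    ⟨fun _ _ _ _ => trivial, fun _ _ _ => trivial, fun _ _ => trivial⟩ ⟨1, trivial, ?_⟩
    (by rw [one_mul]; exact ht0) (fun x _ => by rw [H.nil, zero_mul])
  intro hc
  have : ∀ c, d x * c * t = 0 := by
    intro c
    have e := hc (x * c)
    have e2 := hc c
    rw [one_mul] at e e2
    rw [H.leib, add_mul, mul_assoc x, e2, mul_zero, add_zero] at e
    exact e
  rcases H.prime _ _ this with h | h
  · exact hx h
  · exact ht0 h

end NilDer

theorem stmt_0 {R : Type*} [Ring R]
    (hprime : ∀ a b : R, (∀ r : R, a * r * b = 0) → a = 0 ∨ b = 0)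
    (d : R → R) (hadd : ∀ x y : R, d (x + y) = d x + d y)
    (hleib : ∀ x y : R, d (x * y) = d x * y + x * d y)
    (n : ℕ) (hn : 1 ≤ n)
    (hid : ∀ x y : R, (d (x * y)) ^ n = (d x) ^ n * (d y) ^ n) :
    (∀ x : R, d x = 0) ∨ (∀ x y : R, x * y = y * x) := by
  left
  have h1 : d 1 = 0 := by
    have := hleib 1 1
    simpa using this
  have hnil : ∀ x, d x ^ n = 0 := by
    intro x
    have := hid x 1
    rw [mul_one, h1, zero_pow (by omega), mul_zero] at this
    exact this
  exact (NilDer.mk hprime hadd hleib hnil : NilDer d n).eq_zero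
end

section
/- Let R be a semiprime ring and d a derivation of R such that (d(xy))^n = (d(x))^n (d(y))^n for all x, y in R, where n ≥ 1 is a fixed integer. Then d maps R into its center, i.e., [d(x), y] = 0 for all x, y in R. -/
theorem aux_comb {R : Type*} [Ring R] (N M t : R) (k : ℕ) (hNM : N * M = 0)
    (h1 : (N + M) ^ (k + 2) * t = 0) (h2 : N ^ (k + 2) * t = 0)
    (h3 : M ^ (k + 2) * ((N + M) ^ k * t) = 0) :
    M ^ (k + 1) * (N ^ (k + 1) * t) = 0 := by
  have hN : ∀ j : ℕ, N * (N + M) ^ j = N ^ (j + 1) := by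
    intro j
    induction j with
    | zero => simp
    | succ j ih =>
      have : N ^ (j + 1) * M = 0 := by rw [pow_succ, mul_assoc, hNM, mul_zero]
      rw [pow_succ (N + M), ← mul_assoc, ih, mul_add, this, add_zero, ← pow_succ]
  have hs : ∀ j : ℕ, (N + M) ^ (j + 1) = N ^ (j + 1) + M * (N + M) ^ j := by
    intro j
    rw [pow_succ', add_mul, hN]
  have e1 : M ^ k * ((N + M) ^ (k + 2) * t) = 0 := by rw [h1, mul_zero]
  rw [hs (k + 1), add_mul, h2, zero_add, hs k] at e1
  have : M ^ k * (M * (N ^ (k + 1) + M * (N + M) ^ k) * t)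
      = M ^ (k + 1) * (N ^ (k + 1) * t) + M ^ (k + 2) * ((N + M) ^ k * t) := by
    rw [pow_succ M (k + 1), pow_succ M k]; noncomm_ring
  rw [this, h3, add_zero] at e1
  exact e1

theorem aux_pow_mul {R : Type*} [Ring R] (a b : R) (k : ℕ) :
    (a * b) ^ k * a = a * (b * a) ^ k := by
  induction k with
  | zero => simp
  | succ k ih =>
    rw [pow_succ', mul_assoc, ih, pow_succ']; noncomm_ring

/-- The lemma of Levitzki. -/
theorem aux_lev {R : Type*} [Ring R]
    (hsemi : ∀ a : R, (∀ r : R, a * r * a = 0) → a = 0) (k : ℕ) :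
    ∀ a : R, (∀ x : R, (a * x) ^ k * a = 0) → a = 0 := by
  induction k with
  | zero => intro a h; simpa using h 0
  | succ k ih =>
    intro a h
    rcases k with _ | k
    · exact hsemi a (fun r => by simpa using h r)
    by_contra ha
    obtain ⟨x, hx⟩ : ∃ x, (a * x) ^ (k + 1) * a ≠ 0 := by
      by_contra hcon
      push Not at hcon
      exact ha (ih a hcon)
    apply hx
    apply ih
    intro y
    have ha' : (a * x) ^ (k + 1) * a = a * (x * a) ^ (k + 1) := aux_pow_mul a x (k + 1)
    refine aux_comb (a * x) ((a * x) ^ (k + 1) * a * y) a k ?_ ?_ (h x) ?_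
    · rw [← mul_assoc, ← mul_assoc, ← pow_succ', h, zero_mul]
    · rw [ha', mul_assoc a, ← mul_add]; exact h _
    · rw [ha', mul_assoc a, ← mul_add, aux_pow_mul, ← mul_assoc, h, zero_mul]

theorem aux_lev' {R : Type*} [Ring R]
    (hsemi : ∀ a : R, (∀ r : R, a * r * a = 0) → a = 0) (k : ℕ)
    (a : R) (h : ∀ x : R, (a * x) ^ k = 0) : a = 0 :=
  aux_lev hsemi k a (fun x => by rw [h, zero_mul])

/-- annihilators are invariant -/
theorem aux_A {R : Type*} [Ring R]
    (hsemi : ∀ a : R, (∀ r : R, a * r * a = 0) → a = 0)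
    (d : R → R) (hleib : ∀ x y : R, d (x * y) = d x * y + x * d y)
    (n : ℕ) (hnil : ∀ x : R, d x ^ n = 0) (v u : R) (huv : v * u = 0) : v * d u = 0 := by
  apply aux_lev hsemi n
  intro x
  have h1 : v * d (u * x * v) = v * d u * x * v := by
    rw [mul_assoc u, hleib, mul_add, ← mul_assoc v u, huv, zero_mul, add_zero]; noncomm_ring
  have h2 : ∀ k : ℕ, v * d (u * x * v) ^ k = (v * d u * x) ^ k * v := by
    intro k
    induction k with
    | zero => simp
    | succ k ih =>
      rw [pow_succ, ← mul_assoc, ih, mul_assoc, h1, pow_succ]; noncomm_ring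
  have h3 := h2 n
  rw [hnil, mul_zero] at h3
  rw [← mul_assoc, ← h3, zero_mul]

/-- Existence of a good element. -/
theorem aux_B {R : Type*} [Ring R]
    (d : R → R) (hadd : ∀ x y : R, d (x + y) = d x + d y)
    (hA : ∀ v u : R, v * u = 0 → v * d u = 0)
    (k : ℕ) : ∀ (b c t : R), t = d b * c → t ≠ 0 →
      (∀ y : R, (∀ v, v * t = 0 → v * y = 0) → d y ^ k * t = 0) →
      ∃ b c t : R, t = d b * c ∧ t ≠ 0 ∧
        ∀ y : R, (∀ v, v * t = 0 → v * y = 0) → d y * t = 0 := by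
  induction k with
  | zero =>
    intro b c t _ h0 h
    exact absurd (by simpa using h 0 (by simp)) h0
  | succ k ih =>
    intro b c t ht h0 h
    rcases k with _ | k
    · exact ⟨b, c, t, ht, h0, by simpa using h⟩
    by_cases hc : ∀ y : R, (∀ v, v * t = 0 → v * y = 0) → d y ^ (k + 1) * t = 0
    · exact ih b c t ht h0 hc
    push Not at hc
    obtain ⟨a, ha, hat⟩ := hc
    have hda : ∀ v, v * t = 0 → v * d a = 0 := fun v hv => hA _ _ (ha v hv)
    have hsub : ∀ v, v * t = 0 → v * (d a ^ (k + 1) * t) = 0 := by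
      intro v hv
      rw [pow_succ', ← mul_assoc, ← mul_assoc, hda v hv, zero_mul, zero_mul]
    refine ih a (d a ^ k * t) (d a ^ (k + 1) * t) (by rw [pow_succ', mul_assoc]) hat ?_
    intro y hy
    have hyt : ∀ v, v * t = 0 → v * y = 0 := fun v hv => hy v (hsub v hv)
    have hdy : ∀ v, v * t = 0 → v * d y = 0 := fun v hv => hA _ _ (hyt v hv)
    refine aux_comb (d a) (d y) t k ?_ ?_ (h a ha) ?_
    · apply hA
      apply hy
      rw [← mul_assoc, ← pow_succ']
      exact h a ha
    · rw [← hadd]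
      apply h
      intro v hv
      rw [mul_add, ha v hv, hyt v hv, add_zero]
    · have h5 : d y ^ (k + 2) * t = 0 := h y hyt
      rcases k with _ | k
      · simpa using h5
      · rw [pow_succ' (d a + d y), ← mul_assoc, ← mul_assoc, mul_add, hda _ h5, hdy _ h5]
        simp

theorem aux_main {R : Type*} [Ring R]
    (hsemi : ∀ a : R, (∀ r : R, a * r * a = 0) → a = 0)
    (d : R → R) (hadd : ∀ x y : R, d (x + y) = d x + d y)
    (hleib : ∀ x y : R, d (x * y) = d x * y + x * d y)
    (n : ℕ) (hnil : ∀ x : R, d x ^ n = 0)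
    (hA : ∀ v u : R, v * u = 0 → v * d u = 0)
    (U : R → Prop) (hUr : ∀ x r, U x → U (x * r)) (hUd : ∀ x, U x → U (d x))
    (hUU : ∀ x y, U x → U y → d x * y = 0) :
    ∀ z x, U x → d z * x = 0 := by
  have h1 : ∀ y r x, U y → U x → d y * r * x = - (y * d r * x) := by
    intro y r x hy hx
    have := hUU (y * r) x (hUr _ _ hy) hx
    rw [hleib, add_mul] at this
    exact eq_neg_of_add_eq_zero_left this
  have h2 : ∀ y r x, U y → U x → d (d y) * r * x = y * d (d r) * x := by
    intro y r x hy hx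
    rw [h1 _ _ _ (hUd _ hy) hx, h1 _ _ _ hy hx, neg_neg]
  -- step 3
  have h3 : ∀ z, (∀ x, U x → d (d z) * x = 0) → ∀ x, U x → d z * x = 0 := by
    intro z hz x hx
    apply aux_lev' hsemi (n + 2)
    intro r
    obtain ⟨y, hy⟩ : ∃ y, y = x * r := ⟨_, rfl⟩
    have hyU : U y := by rw [hy]; exact hUr _ _ hx
    have e1 : d y * d (z * y) = -(y * d z) * d y := by
      rw [hleib, mul_add, ← mul_assoc, ← mul_assoc, h1 y (d z) y hyU hyU,
        h1 y z (d y) hyU (hUd _ hyU), mul_assoc y, hz y hyU]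
      simp
    have e2 : ∀ k : ℕ, d y * d (z * y) ^ k = (-(y * d z)) ^ k * d y := by
      intro k
      induction k with
      | zero => simp
      | succ k ih => rw [pow_succ, ← mul_assoc, ih, mul_assoc, e1, pow_succ]; exact (mul_assoc _ _ _).symm
    have e3 := e2 n
    rw [hnil, mul_zero] at e3
    have e4 : (-(y * d z)) ^ (n + 1) * y = 0 := by
      have : (-(y * d z)) ^ n * d y * (z * y) = 0 := by rw [← e3, zero_mul]
      have b : d y * (z * y) = -(y * d z) * y := by
        rw [← mul_assoc, h1 y z y hyU hyU, neg_mul]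
      rw [mul_assoc, b, ← mul_assoc] at this
      rw [pow_succ]; exact this
    have e5 : (y * d z) ^ (n + 1) * y = 0 := by
      rcases neg_one_pow_eq_or R (n + 1) with h | h
      · rw [neg_pow, h, one_mul] at e4; exact e4
      · rw [neg_pow, h, neg_mul, one_mul, neg_mul, neg_eq_zero] at e4; exact e4
    rw [aux_pow_mul] at e5
    rw [mul_assoc (d z) x r, ← hy, pow_succ' _ (n + 1), mul_assoc, e5, mul_zero]
  -- left version of the invariance
  have hA' : ∀ v u : R, v * u = 0 → d v * u = 0 := by
    intro v u h
    have h0 : d 0 = 0 := by simpa using hadd 0 0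
    have := hleib v u
    rw [h, h0, hA v u h, add_zero] at this
    exact this.symm
  -- Fact F
  have hF : ∀ v m, v * m = 0 → ∀ s u, U s → U u → ∀ r, d (d m) * s * r * (v * u) = 0 := by
    intro v m hvm s0 u hs0 hu r0
    set s := s0 * r0 with hsdef
    have hs : U s := hUr _ _ hs0
    have goal' : d (d m) * s * v * u = 0 := by
      apply aux_lev' hsemi (n + 2)
      intro r
      set y := u * r with hy
      have hyU : U y := hUr _ _ hu
      have hvm1 := hA v m hvm
      have hvm2 := hA' v m hvm
      have hvm3 := hA _ _ hvm2
      set M1 := d y with hM1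
      set M2 := d (m * s * v) with hM2
      have f1 : M1 * M1 = 0 := hUU _ _ hyU (hUd _ hyU)
      have f2 : M2 * M2 = 0 := by
        have e : M2 = (d m * s + m * d s) * v + m * s * d v := by
          rw [hM2, hleib, hleib]
        have a1 : v * M2 = 0 := by
          rw [e]
          calc v * ((d m * s + m * d s) * v + m * s * d v)
              = (v * d m) * s * v + (v * m) * d s * v + (v * m) * s * d v := by noncomm_ring
            _ = 0 := by rw [hvm, hvm1]; simp
        have a2 : d v * M2 = 0 := by
          rw [e]
          calc d v * ((d m * s + m * d s) * v + m * s * d v)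
              = (d v * d m) * s * v + (d v * m) * d s * v + (d v * m) * s * d v := by
                noncomm_ring
            _ = 0 := by rw [hvm2, hvm3]; simp
        nth_rewrite 1 [e]
        rw [add_mul, mul_assoc _ v, a1, mul_assoc _ (d v), a2]
        simp
      have f3 : M1 * M2 * M1 = -(y * d (d m) * s * v) * M1 := by
        have e : M2 = d m * (s * v) + m * d (s * v) := by
          rw [hM2, mul_assoc, hleib]
        have hsv : U (s * v) := hUr _ _ hs
        have b1 : d (s * v) * M1 = 0 := hUU _ _ hsv (hUd _ hyU)
        have b2 : M1 * d m * (s * v) = -(y * d (d m) * (s * v)) := h1 _ _ _ hyU hsv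
        have : M1 * M2 * M1 = (M1 * d m * (s * v)) * M1 + M1 * m * (d (s * v) * M1) := by
          rw [e]; noncomm_ring
        rw [this, b1, b2]; noncomm_ring
      have f4 : ∀ k : ℕ, M1 * ((M1 + M2) ^ 2) ^ k = (-(y * d (d m) * s * v)) ^ k * M1 := by
        intro k
        induction k with
        | zero => simp
        | succ k ih =>
          have : (M1 + M2) ^ 2 = M1 * M2 + M2 * M1 := by
            have : (M1 + M2) ^ 2 = M1 * M1 + M1 * M2 + M2 * M1 + M2 * M2 := by noncomm_ring
            rw [this, f1, f2]; simp
          rw [pow_succ, ← mul_assoc, ih, this, mul_assoc, mul_add, ← mul_assoc M1 M1, f1,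
            zero_mul, zero_add, ← mul_assoc M1, f3, pow_succ]
          exact (mul_assoc _ _ _).symm
      have f5 := f4 n
      rw [← pow_mul, mul_comm 2 n, pow_mul, hM1, hM2, ← hadd, hnil, zero_pow two_ne_zero,
        mul_zero] at f5
      have f6 : (-(y * d (d m) * s * v)) ^ (n + 1) = 0 := by
        have : (-(y * d (d m) * s * v)) ^ n * d y * (d m * s * v) = 0 := by
          rw [← f5, zero_mul]
        have b3 : d y * (d m * s * v) = -(y * d (d m) * s * v) := by
          rw [← mul_assoc, ← mul_assoc, h1 y (d m) s hyU hs, neg_mul]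
        rw [mul_assoc, b3] at this
        rw [pow_succ]; exact this
      have f7 : (y * (d (d m) * s * v)) ^ (n + 1) = 0 := by
        have e : y * (d (d m) * s * v) = y * d (d m) * s * v := by noncomm_ring
        rw [e]
        rcases neg_one_pow_eq_or R (n + 1) with h | h
        · rw [neg_pow, h, one_mul] at f6; exact f6
        · rw [neg_pow, h, neg_mul, one_mul, neg_eq_zero] at f6; exact f6
      rw [mul_assoc (d (d m) * s * v), ← hy, pow_succ, ← mul_assoc, aux_pow_mul, f7,
        mul_zero, zero_mul]
    rw [← goal', hsdef]; noncomm_ring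
  -- step 5
  have h5 : ∀ y z x, U y → U x → d (d y) * ((1 + d z) * x) = 0 := by
    intro y z x hy hx
    set l := d (d y) with hl
    set a := d z with ha
    set g : R := ∑ i ∈ Finset.range n, (-a) ^ i with hg
    have han : (-a) ^ n = 0 := by rw [neg_pow, ha, hnil, mul_zero]
    have hhg : (1 + a) * g = 1 := by
      have := mul_neg_geom_sum (-a) n
      rw [han, sub_zero, sub_neg_eq_add] at this
      exact this
    have hgh : g * (1 + a) = 1 := by
      have := geom_sum_mul_neg (-a) n
      rw [han, sub_zero, sub_neg_eq_add] at this
      exact this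
    have hcomm : Commute g (-a) := by
      have : Commute g (1 + a) := by rw [Commute, SemiconjBy, hhg, hgh]
      have h' := (this.sub_right (Commute.one_right g)).neg_right
      simpa using h'
    have hb : (1 - g) ^ n = 0 := by
      have e : 1 - g = g * a := by
        rw [← hgh]; noncomm_ring
      have e' : (1 - g) = - (g * (-a)) := by rw [e]; noncomm_ring
      rw [e', neg_pow, hcomm.mul_pow, han, mul_zero, mul_zero]
    have hh : 1 + a = ∑ i ∈ Finset.range n, (1 - g) ^ i := by
      have := geom_sum_mul_neg (1 - g) n
      rw [hb, sub_zero, sub_sub_cancel] at this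
      calc 1 + a = (∑ i ∈ Finset.range n, (1 - g) ^ i) * g * (1 + a) := by rw [this, one_mul]
        _ = _ := by rw [mul_assoc, hgh, mul_one]
    set e := l * ((1 + a) * x) with he
    -- key
    have key : ∀ m, l * m = 0 → ∀ r, l * (g * m) * r * e = 0 := by
      intro m hm r
      have hz : ∀ r1 r2, l * (g * m) * r1 * x * r2 * e = 0 := by
        intro r1 r2
        have hv : (l * (1 + a)) * (g * m * r1) = 0 := by
          calc (l * (1 + a)) * (g * m * r1) = l * ((1 + a) * g) * m * r1 := by noncomm_ring
            _ = 0 := by rw [hhg, mul_one, hm, zero_mul]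
        have := hF _ _ hv x x hx hx r2
        have e6 := h2 y (g * m * r1) x hy hx
        calc l * (g * m) * r1 * x * r2 * e
            = (l * (g * m * r1) * x) * r2 * (l * (1 + a) * x) := by
              rw [he]; simp only [mul_assoc]
          _ = y * (d (d (g * m * r1)) * x * r2 * (l * (1 + a) * x)) := by
              rw [hl, e6]; simp only [mul_assoc]
          _ = 0 := by rw [this, mul_zero]
      apply hsemi
      intro s
      have := hz (r * l * (1 + a)) (s * (l * (g * m)) * r)
      rw [← this]
      simp only [he, mul_assoc]
    have key2 : ∀ m, (∀ r, l * m * r * e = 0) → ∀ r, l * (g * m) * r * e = 0 := by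
      intro m hm r
      have hm' : l * (m * r * e) = 0 := by
        have := hm r
        rw [← this]; simp only [mul_assoc]
      apply hsemi
      intro s
      have := key _ hm' (s * (l * (g * m)) * r)
      rw [← this]
      simp only [mul_assoc]
    have key3 : ∀ i : ℕ, ∀ r, l * ((1 - g) ^ i * x) * r * e = 0 := by
      intro i
      induction i with
      | zero =>
        intro r
        have : l * x = 0 := hUU _ _ (hUd _ hy) hx
        simp [this]
      | succ i ih =>
        intro r
        have e1 := ih r
        have e2 := key2 _ ih r
        have : l * ((1 - g) ^ (i + 1) * x) * r * e
            = l * ((1 - g) ^ i * x) * r * e - l * (g * ((1 - g) ^ i * x)) * r * e := by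
          rw [pow_succ']; noncomm_ring
        rw [this, e1, e2, sub_zero]
    apply hsemi
    intro r
    have : e = ∑ i ∈ Finset.range n, l * ((1 - g) ^ i * x) := by
      rw [he, hh, Finset.sum_mul, Finset.mul_sum]
    nth_rewrite 1 [this]
    rw [Finset.sum_mul, Finset.sum_mul]
    exact Finset.sum_eq_zero (fun i _ => key3 i r)
  have h6 : ∀ z x, U x → d (d (d z)) * x = 0 := by
    intro z x hx
    have h7 : ∀ y, U y → y * d (d (d z)) * x = 0 := by
      intro y hy
      have e1 := h5 y z x hy hx
      have e2 : d (d y) * x = 0 := hUU _ _ (hUd _ hy) hx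
      rw [add_mul, one_mul, mul_add, e2, zero_add, ← mul_assoc, h2 _ _ _ hy hx] at e1
      exact e1
    apply hsemi
    intro r
    have := h7 (x * r) (hUr _ _ hx)
    calc d (d (d z)) * x * r * (d (d (d z)) * x)
        = d (d (d z)) * (x * r * d (d (d z)) * x) := by simp only [mul_assoc]
      _ = 0 := by rw [this, mul_zero]
  intro z
  exact h3 z (h3 (d z) (h6 z))

theorem stmt_1 {R : Type*} [Ring R]
    (hsemi : ∀ a : R, (∀ r : R, a * r * a = 0) → a = 0)
    (d : R → R) (hadd : ∀ x y : R, d (x + y) = d x + d y)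
    (hleib : ∀ x y : R, d (x * y) = d x * y + x * d y)
    (n : ℕ) (hn : 1 ≤ n)
    (hid : ∀ x y : R, (d (x * y)) ^ n = (d x) ^ n * (d y) ^ n) :
    ∀ x y : R, d x * y - y * d x = 0 := by
  have hd1 : d 1 = 0 := by
    have := hleib 1 1
    simpa using this
  have hnil : ∀ x, d x ^ n = 0 := by
    intro x
    have := hid x 1
    rw [hd1, zero_pow (by omega), mul_zero, mul_one] at this
    exact this
  have hA := aux_A hsemi d hleib n hnil
  suffices h : ∀ x, d x = 0 by
    intro x y
    simp [h]
  intro a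
  by_contra ha
  obtain ⟨b, c, t, ht, h0, hT⟩ := aux_B d hadd hA n a 1 (d a) (by simp) ha
    (fun y _ => by rw [hnil, zero_mul])
  have hmain := aux_main hsemi d hadd hleib n hnil hA (fun x => ∀ v, v * t = 0 → v * x = 0)
    (fun x r hx v hv => by rw [← mul_assoc, hx v hv, zero_mul])
    (fun x hx v hv => hA _ _ (hx v hv))
    (fun x y hx hy => hy _ (hT x hx))
  have hz : ∀ z, d z * t = 0 := fun z => hmain z t (fun v hv => hv)
  have hzw : ∀ z w, d z * w * t = 0 := by
    intro z w
    have := hz (z * w)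
    rw [hleib, add_mul, mul_assoc z, hz w, mul_zero, add_zero] at this
    exact this
  apply h0
  apply hsemi
  intro r
  nth_rewrite 1 [ht]
  rw [mul_assoc (d b)]
  exact hzw b (c * r)
end
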